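/- Let F be a real vector space, let λ₁,…,λ_m be linear functionals on F with observation map Λ(f) = (λ₁(f),…,λ_m(f)), and let K ⊆ F be a set containing 0. Let I be a nonempty index set and let γ_i (i ∈ I) be linear functionals on F such that γ(f) := sup_{i∈I} γ_i(f) is finite for every f ∈ F. Let e ≥ 0 and suppose that for each i ∈ I there is a vector c^{(i)} ∈ ℝ^m such that for all f′, f″ ∈ K: ( γ_i(f′) − Σ_{k=1}^m c_k^{(i)} λ_k(f′) ) − ( γ(f″) − Σ_{k=1}^m c_k^{(i)} λ_k(f″) ) ≤ 2e. Define c₀^{(i)} := inf_{f∈K} ( γ(f) − Σ_{k=1}^m c_k^{(i)} λ_k(f) ) + e for each i ∈ I. Then for every f ∈ K, the value δ(Λ(f)) := sup_{i∈I} ( c₀^{(i)} + Σ_{k=1}^m c_k^{(i)} λ_k(f) ) is finite and satisfies |γ(f) − δ(Λ(f))| ≤ e. -/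

import Mathlib

/-- **Combination step in the construction of an optimal sup-affine estimation
functional.** Given coefficient vectors `c i` satisfying the key two-point inequality
on `K` with slack `2e`, the constants `c0 i := inf_{f ∈ K} (γ f − ∑ k, c i k * λ k f) + e`
yield, for every `f ∈ K`, a finite value `d = sup_i (c0 i + ∑ k, c i k * λ k f)`
with `|γ f − d| ≤ e`. -/
theorem stmt_15 {F : Type*} [AddCommGroup F] [Module ℝ F] {m : ℕ}
    (lam : Fin m → F →ₗ[ℝ] ℝ)
    (K : Set F) (h0K : (0 : F) ∈ K)
    {I : Type*} [Nonempty I] (γi : I → F →ₗ[ℝ] ℝ)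
    (γ : F → ℝ) (hγ : ∀ f, IsLUB (Set.range fun i => γi i f) (γ f))
    (e : ℝ) (he : 0 ≤ e)
    (c : I → Fin m → ℝ)
    (hc : ∀ i, ∀ f' ∈ K, ∀ f'' ∈ K,
      (γi i f' - ∑ k, c i k * lam k f') - (γ f'' - ∑ k, c i k * lam k f'') ≤ 2 * e)
    (c0 : I → ℝ)
    (hc0 : ∀ i, c0 i = sInf {x : ℝ | ∃ f ∈ K, x = γ f - ∑ k, c i k * lam k f} + e) :
    ∀ f ∈ K, ∃ d : ℝ,
      IsLUB (Set.range fun i => c0 i + ∑ k, c i k * lam k f) d ∧ |γ f - d| ≤ e := by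
  intro f hf
  have hup : ∀ i, c0 i + ∑ k, c i k * lam k f ≤ γ f + e := by
    intro i
    have h : sInf {x : ℝ | ∃ f ∈ K, x = γ f - ∑ k, c i k * lam k f}
        ≤ γ f - ∑ k, c i k * lam k f := by
      refine csInf_le ⟨γi i f - ∑ k, c i k * lam k f - 2 * e, ?_⟩ ⟨f, hf, rfl⟩
      rintro x ⟨g, hg, rfl⟩
      linarith [hc i f hf g hg]
    rw [hc0 i]
    linarith
  have hlow : ∀ i, γi i f - e ≤ c0 i + ∑ k, c i k * lam k f := by
    intro i
    have h : γi i f - ∑ k, c i k * lam k f - 2 * e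
        ≤ sInf {x : ℝ | ∃ f ∈ K, x = γ f - ∑ k, c i k * lam k f} := by
      refine le_csInf ⟨_, f, hf, rfl⟩ ?_
      rintro x ⟨g, hg, rfl⟩
      linarith [hc i f hf g hg]
    rw [hc0 i]
    linarith
  obtain ⟨d, hd⟩ := Real.exists_isLUB
    (Set.range_nonempty fun i => c0 i + ∑ k, c i k * lam k f)
    ⟨γ f + e, by rintro x ⟨i, rfl⟩; exact hup i⟩
  refine ⟨d, hd, ?_⟩
  have h1 : d ≤ γ f + e := hd.2 (by rintro x ⟨i, rfl⟩; exact hup i)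
  have h2 : γ f ≤ d + e := (hγ f).2 (by
    rintro x ⟨i, rfl⟩
    have h3 : c0 i + ∑ k, c i k * lam k f ≤ d := hd.1 ⟨i, rfl⟩
    have h4 := hlow i
    show γi i f ≤ d + e
    linarith)
  rw [abs_le]
  constructor <;> linarith
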